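/- For every point x of the homogeneous Cantor set E with unique coding (d_i), the pointwise upper s-density of μ at x equals Θ^{*s}(μ,x) = max{ 1/(2^s (liminf_{n→∞} η_n(x))^s), limsup_{n→∞} (1 + 2 d̂_n)/(2^s (d̂_n R/ρ + η_n(x))^s) }, where η_n(x) := max{T^n x, 1 − T^n x} and d̂_n := min{d_n, N−1−d_n}. -/

import Mathlib

open MeasureTheory Filter Set Topology ENNReal

namespace HomogeneousCantorDensity

noncomputable def R (N : ℕ) (ρ : ℝ) : ℝ := (1 - ρ) / ((N : ℝ) - 1)

noncomputable def f (N : ℕ) (ρ : ℝ) (i : ℕ) (x : ℝ) : ℝ := ρ * x + (i : ℝ) * R N ρ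

noncomputable def piMap (N : ℕ) (ρ : ℝ) (d : ℕ → ℕ) : ℝ :=
  R N ρ * ∑' i : ℕ, (d i : ℝ) * ρ ^ i

def cantorE (N : ℕ) (ρ : ℝ) : Set ℝ :=
  {x | ∃ d : ℕ → ℕ, (∀ i, d i < N) ∧ x = piMap N ρ d}

/-- `μ = ∑_{i=0}^{N-1} (1/N) μ ∘ f_i⁻¹`. -/
def IsSelfSimilar (N : ℕ) (ρ : ℝ) (μ : Measure ℝ) : Prop :=
  μ = ∑ i ∈ Finset.range N, (N : ℝ≥0∞)⁻¹ • μ.map (f N ρ i)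

/-- `T^n x` for `x = piMap N ρ d`. -/
noncomputable def Tn (N : ℕ) (ρ : ℝ) (d : ℕ → ℕ) (n : ℕ) : ℝ :=
  piMap N ρ (fun i => d (n + i))

/-- pointwise lower `s`-density of `μ` at `x`. -/
noncomputable def lowerDensity (μ : Measure ℝ) (s x : ℝ) : ℝ :=
  liminf (fun r : ℝ => (μ (Ioo (x - r) (x + r))).toReal / (2 * r) ^ s) (𝓝[>] 0)

/-- pointwise upper `s`-density of `μ` at `x`. -/
noncomputable def upperDensity (μ : Measure ℝ) (s x : ℝ) : ℝ :=
  limsup (fun r : ℝ => (μ (Ioo (x - r) (x + r))).toReal / (2 * r) ^ s) (𝓝[>] 0)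

/-- Upper bound for the mass of an initial or final piece of length `v` of the Cantor measure. -/
noncomputable def phi (v : ℝ) : ℝ := if v ≤ 0 then 0 else min 1 ((1 + v) / 2)

lemma phi_le_one (v : ℝ) : phi v ≤ 1 := by
  unfold phi; split_ifs
  · norm_num
  · exact min_le_left _ _

lemma phi_le (v : ℝ) (hv : 0 ≤ v) : phi v ≤ (1 + v) / 2 := by
  unfold phi; split_ifs
  · linarith
  · exact min_le_right _ _

lemma phi_zero {v : ℝ} (hv : v ≤ 0) : phi v = 0 := by
  unfold phi; rw [if_pos hv]

lemma chord {C s P Q u p q : ℝ} (hC : 0 ≤ C) (hs0 : 0 ≤ s) (hs1 : s ≤ 1) (hP : 0 ≤ P)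
    (hPQ : P < Q) (hPu : P ≤ u) (huQ : u ≤ Q) (hp : p ≤ C * P ^ s) (hq : q ≤ C * Q ^ s) :
    q - (q - p) * ((Q - u) / (Q - P)) ≤ C * u ^ s := by
  have hc := @(Real.concaveOn_rpow hs0 hs1).2 P hP Q (show 0 ≤ Q by linarith)
    ((Q - u) / (Q - P)) ((u - P) / (Q - P))
    (div_nonneg (by linarith) (by linarith)) (div_nonneg (by linarith) (by linarith))
    (by have : Q - P ≠ 0 := by linarith
        field_simp; ring)
  have hne : Q - P ≠ 0 := by linarith
  have he : ((Q - u) / (Q - P)) • P + ((u - P) / (Q - P)) • Q = u := by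
    simp only [smul_eq_mul]; field_simp; ring
  rw [he] at hc
  simp only [smul_eq_mul] at hc
  have hl0 : 0 ≤ (Q - u) / (Q - P) := div_nonneg (by linarith) (by linarith)
  have hl1 : 0 ≤ (u - P) / (Q - P) := div_nonneg (by linarith) (by linarith)
  have hsum : (u - P) / (Q - P) = 1 - (Q - u) / (Q - P) := by field_simp; ring
  have h1 := mul_le_mul_of_nonneg_left hp hl0
  have h2 := mul_le_mul_of_nonneg_left hq hl1
  have h3 := mul_le_mul_of_nonneg_left hc hC
  rw [hsum] at h2 h3
  nlinarith

lemma sum_bound (g : ℕ → ℝ) (j : ℕ) (h1 : ∀ q, g q ≤ 1) (h0 : ∀ q, j < q → g q ≤ 0) (K : ℕ)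
    (hK : j < K) : ∑ q ∈ Finset.range K, g q ≤ j + g j := by
  induction K with
  | zero => omega
  | succ K ih =>
    rw [Finset.sum_range_succ]
    rcases Nat.lt_or_ge j K with h | h
    · have := ih h
      have := h0 K h
      linarith
    · have : K = j := by omega
      subst this
      have : ∑ q ∈ Finset.range K, g q ≤ ∑ q ∈ Finset.range K, (1 : ℝ) :=
        Finset.sum_le_sum (fun q _ => h1 q)
      simp at this
      linarith

lemma sqrt_chord {P Q u : ℝ} (hP : 0 ≤ P) (hPQ : P < Q) (hPu : P ≤ u) (huQ : u ≤ Q) :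
    (Q - u) * √P + (u - P) * √Q ≤ (Q - P) * √u := by
  have := chord (C := 1) (s := 1/2) (P := P) (Q := Q) (u := u) (p := √P) (q := √Q)
    (by norm_num) (by norm_num) (by norm_num) hP hPQ hPu huQ
    (by rw [Real.sqrt_eq_rpow]; simp) (by rw [Real.sqrt_eq_rpow]; simp)
  rw [one_mul, ← Real.sqrt_eq_rpow] at this
  have h2 : 0 < Q - P := by linarith
  have h3 := mul_le_mul_of_nonneg_left this h2.le
  have h4 : (Q - P) * (√Q - (√Q - √P) * ((Q - u) / (Q - P))) =
      (Q - u) * √P + (u - P) * √Q := by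
    field_simp; ring
  linarith

lemma sqrt_three {k a η w : ℝ} (hk : 0 ≤ k) (ha : 2 * k + 4 ≤ a) (_hw0 : 0 ≤ w) (hw1 : w ≤ 1)
    (hη : 0 ≤ η) (hη1 : 0 ≤ η - w) (hη2 : η - w = (1 - w) / 2 ∨ w = 0 ∧ η ≤ 1) :
    √((k + 2) * a + (η - w)) + √(k * a + η) ≤ 2 * √((k + 1) * a + (η - w)) := by
  set u := (k + 1) * a + (η - w) with hu
  have ha0 : 0 < a := by linarith
  have hka : 0 ≤ k * a := by positivity
  have hu0 : a ≤ u := by rw [hu]; nlinarith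
  have e1 : (k + 2) * a + (η - w) = u + a := by rw [hu]; ring
  have e2 : k * a + η = u - a + w := by rw [hu]; ring
  rw [e1, e2]
  have hmul : √(u + a) * √(u - a + w) ≤ (2 * u - w) / 2 := by
    rw [← Real.sqrt_mul (by linarith)]
    apply Real.sqrt_le_iff.2
    constructor
    · linarith
    · have hkey : 8 * w * u + 4 * a * w ≤ 4 * a ^ 2 + w ^ 2 := by
        rcases hη2 with h | ⟨h, _⟩
        · have hu' : u = (k + 1) * a + (1 - w) / 2 := by rw [hu, h]
          have h1 : 4 * a * (2 * k + 4) ≤ 4 * a ^ 2 := by nlinarith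
          have h2 : w * (k * a) ≤ k * a := by nlinarith
          have h3 : w * a ≤ a := by nlinarith
          rw [hu']
          nlinarith
        · rw [h]; nlinarith
      nlinarith
  have s1 := Real.sq_sqrt (show 0 ≤ u + a by linarith)
  have s2 := Real.sq_sqrt (show 0 ≤ u - a + w by linarith)
  have s3 := Real.sq_sqrt (show 0 ≤ u by linarith)
  refine (pow_le_pow_iff_left₀ (by positivity) (by positivity) two_ne_zero).1 ?_
  nlinarith

lemma pts2_aux {K M i a b SA SM Si T S2 : ℝ} (ha0 : 0 < a) (hKi : K + 1 ≤ i) (hiMr : i + 1 ≤ M)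
    (c1 : (M * a + b - (i * a + b)) * T + (i * a + b - ((K + 1) * a + b)) * SM ≤
      (M * a + b - ((K + 1) * a + b)) * Si)
    (c2 : (M * a + b - ((K + 2) * a + b)) * T + ((K + 2) * a + b - ((K + 1) * a + b)) * SM ≤
      (M * a + b - ((K + 1) * a + b)) * S2)
    (h3 : S2 + SA ≤ 2 * T) :
    (M - i) * SA + (i - K) * SM ≤ (M - K) * Si := by
  have c1' : (M - i) * T + (i - (K + 1)) * SM ≤ (M - (K + 1)) * Si := by
    refine le_of_mul_le_mul_left ?_ ha0
    linarith
  have c2' : (M - (K + 2)) * T + SM ≤ (M - (K + 1)) * S2 := by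
    refine le_of_mul_le_mul_left ?_ ha0
    linarith
  have hn : 0 < M - (K + 1) := by linarith
  have h4 := mul_le_mul_of_nonneg_left h3 hn.le
  have c3 : (M - (K + 1)) * SA + SM ≤ (M - K) * T := by linarith
  refine le_of_mul_le_mul_left ?_ hn
  have e1 := mul_le_mul_of_nonneg_left c1' (show 0 ≤ M - K by linarith)
  have e2 := mul_le_mul_of_nonneg_left c3 (show 0 ≤ M - i by linarith)
  linarith

lemma pts2_aux2 {K M i SA SM : ℝ} (hne : SM - SA ≠ 0) (h : M - K ≠ 0) :
    1 + K + M - (1 + K + M - (1 + 2 * K)) *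
      ((SM - ((M - i) * SA + (i - K) * SM) / (M - K)) / (SM - SA)) = 1 + K + i := by
  have : SM - ((M - i) * SA + (i - K) * SM) / (M - K) = (M - i) / (M - K) * (SM - SA) := by
    field_simp; ring
  rw [this, mul_div_assoc, div_self hne, mul_one]
  field_simp; ring

set_option maxHeartbeats 1000000 in
lemma pts2 {K M i : ℕ} {a z s C : ℝ} (ha : (K : ℝ) + M + 2 ≤ a) (hz0 : 0 ≤ z) (hz1 : z ≤ 1)
    (hs0 : 0 ≤ s) (hs1 : s ≤ 1 / 2) (hC : 0 ≤ C)
    (h1 : 1 + 2 * (K : ℝ) ≤ C * (K * a + max z (1 - z)) ^ s)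
    (h2 : 1 + (K : ℝ) + M ≤ C * (M * a + (1 - z)) ^ s) (hi : K < i) (hiM : i ≤ M) :
    1 + (K : ℝ) + i ≤ C * (i * a + (1 - z)) ^ s := by
  rcases Nat.lt_or_ge i M with him | him
  swap
  · have : i = M := by omega
    rw [this]; exact h2
  have hKr : (0 : ℝ) ≤ K := by positivity
  have hKi : (K : ℝ) + 1 ≤ i := by exact_mod_cast hi
  have hiMr : (i : ℝ) + 1 ≤ M := by exact_mod_cast him
  have ha0 : 0 < a := by linarith
  set η := max z (1 - z) with hη
  set w := η - (1 - z) with hw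
  have hη1 : 1 - z ≤ η := le_max_right _ _
  have hη2 : η ≤ 1 := max_le (by linarith) (by linarith)
  have ewz : 1 - z = η - w := by rw [hw]; ring
  have h3 := sqrt_three (k := K) (a := a) (η := η) (w := w) hKr (by linarith) (by linarith)
    (by linarith) (by linarith) (by linarith) (by
      rcases le_total z (1 - z) with h | h
      · right
        have : η = 1 - z := max_eq_right h
        exact ⟨by rw [hw, this]; ring, hη2⟩
      · left
        have : η = z := max_eq_left h
        rw [hw, this]; ring)
  rw [← ewz] at h3
  have hzz : 0 ≤ 1 - z := by linarith
  have hKa : 0 ≤ (K : ℝ) * a := by positivity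
  have c1 := sqrt_chord (P := ((K : ℝ) + 1) * a + (1 - z)) (Q := M * a + (1 - z))
    (u := i * a + (1 - z)) (by positivity) (by nlinarith) (by nlinarith) (by nlinarith)
  have c2 := sqrt_chord (P := ((K : ℝ) + 1) * a + (1 - z)) (Q := M * a + (1 - z))
    (u := ((K : ℝ) + 2) * a + (1 - z)) (by positivity) (by nlinarith) (by nlinarith) (by nlinarith)
  have hMp : 0 ≤ (M : ℝ) * a := by positivity
  have hip : 0 ≤ (i : ℝ) * a := by positivity
  have hlt : √(K * a + η) < √(M * a + (1 - z)) :=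
    Real.sqrt_lt_sqrt (by linarith) (by nlinarith)
  have hA0 := Real.sqrt_nonneg (K * a + η)
  have eA : C * (K * a + η) ^ s = C * √(K * a + η) ^ (2 * s) := by
    rw [Real.sqrt_eq_rpow, ← Real.rpow_mul (by linarith)]; congr 2; ring
  have eM : C * (M * a + (1 - z)) ^ s = C * √(M * a + (1 - z)) ^ (2 * s) := by
    rw [Real.sqrt_eq_rpow, ← Real.rpow_mul (by linarith)]; congr 2; ring
  have ei : C * (i * a + (1 - z)) ^ s = C * √(i * a + (1 - z)) ^ (2 * s) := by
    rw [Real.sqrt_eq_rpow, ← Real.rpow_mul (by linarith)]; congr 2; ring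
  rw [eA] at h1
  rw [eM] at h2
  rw [ei]
  set SA := √(K * a + η)
  set SM := √(M * a + (1 - z))
  set Si := √(i * a + (1 - z))
  set T := √(((K : ℝ) + 1) * a + (1 - z))
  set S2 := √(((K : ℝ) + 2) * a + (1 - z))
  have c4 : ((M : ℝ) - i) * SA + (i - K) * SM ≤ (M - K) * Si :=
    pts2_aux ha0 hKi hiMr c1 c2 h3
  have hMK : (0 : ℝ) < M - K := by linarith
  set u0 := (((M : ℝ) - i) * SA + (i - K) * SM) / (M - K) with hu0
  have hu0i : u0 ≤ Si := by rw [hu0, div_le_iff₀ hMK]; linarith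
  have hu0A : SA ≤ u0 := by
    rw [hu0, le_div_iff₀ hMK]
    have := mul_nonneg (show (0 : ℝ) ≤ i - K by linarith) (sub_nonneg.2 hlt.le)
    linarith
  have hu0M : u0 ≤ SM := by
    rw [hu0, div_le_iff₀ hMK]
    have := mul_nonneg (show (0 : ℝ) ≤ M - i by linarith) (sub_nonneg.2 hlt.le)
    linarith
  have := chord hC (show 0 ≤ 2 * s by linarith) (by linarith) hA0 hlt hu0A hu0M h1 h2
  have hne : SM - SA ≠ 0 := by linarith
  have e : 1 + (K : ℝ) + M - (1 + K + M - (1 + 2 * K)) * ((SM - u0) / (SM - SA)) = 1 + K + i := by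
    exact pts2_aux2 hne hMK.ne'
  rw [e] at this
  refine this.trans (mul_le_mul_of_nonneg_left ?_ hC)
  exact Real.rpow_le_rpow (by linarith) hu0i (by linarith)

set_option maxHeartbeats 1000000 in
lemma key_aux {K M : ℕ} {a z s C u : ℝ} (hKM : K ≤ M) (hM1 : 1 ≤ M) (ha : (K : ℝ) + M + 2 ≤ a)
    (hz0 : 0 ≤ z) (hz1 : z ≤ 1) (hs0 : 0 ≤ s) (hs1 : s ≤ 1 / 2) (hC : 0 ≤ C)
    (h0 : 1 ≤ C * (max z (1 - z)) ^ s)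
    (h1 : 1 + 2 * (K : ℝ) ≤ C * (K * a + max z (1 - z)) ^ s)
    (h2 : 1 + (K : ℝ) + M ≤ C * (max (K * a + z) (M * a + (1 - z))) ^ s)
    (hu0 : max z (1 - z) ≤ u) (hu1 : u ≤ max (K * a + z) (M * a + (1 - z))) :
    1 + ∑ q ∈ Finset.range K, phi (u - ((q : ℝ) + 1) * a + (1 - z)) +
      ∑ q ∈ Finset.range M, phi (u - ((q : ℝ) + 1) * a + z) ≤ C * u ^ s := by
  have hη1 : 1 - z ≤ max z (1 - z) := le_max_right _ _
  have hη1' : z ≤ max z (1 - z) := le_max_left _ _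
  have hη2 : max z (1 - z) ≤ 1 := max_le (by linarith) (by linarith)
  have hηz : max z (1 - z) = z ∨ max z (1 - z) = 1 - z := by
    rcases le_total z (1 - z) with h | h
    · right; exact max_eq_right h
    · left; exact max_eq_left h
  set η := max z (1 - z) with hη
  have hKr : (0 : ℝ) ≤ K := by positivity
  have hM1r : (1 : ℝ) ≤ M := by exact_mod_cast hM1
  have hKMr : (K : ℝ) ≤ M := by exact_mod_cast hKM
  have ha0 : 0 < a := by linarith
  have hKa : 0 ≤ (K : ℝ) * a := by positivity
  by_cases hph : 1 ≤ K ∧ u ≤ K * a + η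
  · obtain ⟨hK1, huK⟩ := hph
    have hK1r : (1 : ℝ) ≤ K := by exact_mod_cast hK1
    have hex : ∃ j : ℕ, u ≤ ((j : ℝ) + 1) * a + η :=
      ⟨K - 1, by push_cast [Nat.cast_sub hK1]; linarith⟩
    classical
    obtain ⟨j, hj, hmin⟩ : ∃ j : ℕ, u ≤ ((j : ℝ) + 1) * a + η ∧
        ∀ l < j, ¬ u ≤ ((l : ℝ) + 1) * a + η :=
      ⟨Nat.find hex, Nat.find_spec hex, fun l hl => Nat.find_min hex hl⟩
    have hjK : j < K := by
      by_contra hcon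
      apply hmin (K - 1) (by omega)
      push_cast [Nat.cast_sub hK1]; linarith
    have hjKr : (j : ℝ) + 1 ≤ K := by exact_mod_cast hjK
    have hjl : j * a + η ≤ u := by
      rcases Nat.eq_zero_or_pos j with h | h
      · subst h; simpa using hu0
      · have := hmin (j - 1) (by omega)
        push_cast [Nat.cast_sub h] at this
        push Not at this
        have e : ((j : ℝ) - 1 + 1) = j := by ring
        rw [e] at this
        exact this.le
    have pts : ∀ i : ℕ, i ≤ K → 1 + 2 * (i : ℝ) ≤ C * (i * a + η) ^ s := by
      intro i hi
      have hir : (i : ℝ) ≤ K := by exact_mod_cast hi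
      have := chord (P := η) (Q := K * a + η) (u := i * a + η) hC hs0 (by linarith) (by linarith)
        (by nlinarith) (by have : 0 ≤ (i : ℝ) * a := by positivity
                           linarith) (by nlinarith) h0 h1
      have e : 1 + 2 * (K : ℝ) - (1 + 2 * K - 1) * ((K * a + η - (i * a + η)) / (K * a + η - η))
          = 1 + 2 * i := by
        have : (K : ℝ) ≠ 0 := by linarith
        have e' : (K * a + η - (i * a + η)) / (K * a + η - η) = (K - i) / K := by
          have : K * a + η - η = K * a := by ring
          rw [this]; field_simp; ring
        rw [e']; field_simp; ring
      linarith
    have p1 := pts j hjK.le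
    have p2 := pts (j + 1) hjK
    push_cast at p2
    have hj0 : 0 ≤ (j : ℝ) * a := by positivity
    have hch := chord hC hs0 (by linarith) (by linarith) (by nlinarith) hjl hj p1 p2
    set δ := ((j : ℝ) + 1) * a + η - u with hδ
    have e : ((j : ℝ) + 1) * a + η - (j * a + η) = a := by ring
    rw [e] at hch
    have b1 := sum_bound (fun q : ℕ => phi (u - ((q : ℝ) + 1) * a + (1 - z))) j
      (fun q => phi_le_one _) (fun q hq => by
        have hqr : (j : ℝ) + 1 ≤ q := by exact_mod_cast hq
        refine (phi_zero ?_).le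
        nlinarith) K hjK
    have b2 := sum_bound (fun q : ℕ => phi (u - ((q : ℝ) + 1) * a + z)) j
      (fun q => phi_le_one _) (fun q hq => by
        have hqr : (j : ℝ) + 1 ≤ q := by exact_mod_cast hq
        refine (phi_zero ?_).le
        nlinarith) M (by omega)
    have e1 : u - ((j : ℝ) + 1) * a + (1 - z) = η - δ + (1 - z) := by rw [hδ]; ring
    have e2 : u - ((j : ℝ) + 1) * a + z = η - δ + z := by rw [hδ]; ring
    rw [e1] at b1
    rw [e2] at b2
    have hδ0 : 0 ≤ δ := by linarith
    have hδa : δ ≤ a := by rw [hδ]; linarith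
    have hfin : phi (η - δ + (1 - z)) + phi (η - δ + z) ≤ 2 - 2 * (δ / a) := by
      have hda : δ / a ≤ 1 := by rw [div_le_one ha0]; exact hδa
      have hda4 : δ / a ≤ δ / 4 := div_le_div_of_nonneg_left hδ0 (by norm_num) (by linarith)
      have key : ∀ x y : ℝ, x = 1 - δ → y ≤ 2 - δ → phi x + phi y ≤ 2 - 2 * (δ / a) := by
        intro x y hx hy
        rcases le_total δ 1 with h | h
        · have := phi_le x (by linarith)
          have := phi_le_one y
          linarith
        · rw [phi_zero (show x ≤ 0 by linarith)]
          rcases le_total δ 2 with h' | h'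
          · have := phi_le_one y
            linarith
          · rw [phi_zero (show y ≤ 0 by linarith)]
            linarith
      rcases hηz with h | h
      · exact key _ _ (by rw [h]; ring) (by linarith)
      · rw [add_comm]
        exact key _ _ (by rw [h]; ring) (by linarith)
    linarith
  · have hph' : K < M ∧ K * a + η ≤ u := by
      rcases Nat.eq_zero_or_pos K with h | h
      · subst h
        exact ⟨hM1, by simpa using hu0⟩
      · have h' : ¬ u ≤ K * a + η := fun hc => hph ⟨h, hc⟩
        push Not at h'
        refine ⟨?_, h'.le⟩
        rcases Nat.lt_or_ge K M with hl | hl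
        · exact hl
        · exfalso
          have : M = K := by omega
          rw [this] at hu1
          have : max (K * a + z) (K * a + (1 - z)) ≤ K * a + η :=
            max_le (by linarith) (by linarith)
          linarith
    obtain ⟨hlt, hKu⟩ := hph'
    have hltr : (K : ℝ) + 1 ≤ M := by exact_mod_cast hlt
    have hL : max (K * a + z) (M * a + (1 - z)) = M * a + (1 - z) :=
      max_eq_right (by nlinarith)
    rw [hL] at h2 hu1
    have pts : ∀ i : ℕ, K < i → i ≤ M → 1 + (K : ℝ) + i ≤ C * (i * a + (1 - z)) ^ s :=
      fun i hi hiM => pts2 ha hz0 hz1 hs0 hs1 hC h1 h2 hi hiM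
    have hex : ∃ j : ℕ, K ≤ j ∧ u ≤ ((j : ℝ) + 1) * a + (1 - z) :=
      ⟨M - 1, by omega, by push_cast [Nat.cast_sub hM1]; linarith⟩
    classical
    obtain ⟨j, ⟨hKj, hj⟩, hmin⟩ : ∃ j : ℕ, (K ≤ j ∧ u ≤ ((j : ℝ) + 1) * a + (1 - z)) ∧
        ∀ l < j, ¬ (K ≤ l ∧ u ≤ ((l : ℝ) + 1) * a + (1 - z)) :=
      ⟨Nat.find hex, Nat.find_spec hex, fun l hl => Nat.find_min hex hl⟩
    have hjM : j < M := by
      by_contra hcon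
      apply hmin (M - 1) (by omega)
      exact ⟨by omega, by push_cast [Nat.cast_sub hM1]; linarith⟩
    have hKjr : (K : ℝ) ≤ j := by exact_mod_cast hKj
    obtain ⟨P, hP0, hPu, hPC, hPQ⟩ : ∃ P : ℝ, 0 ≤ P ∧ P ≤ u ∧ 1 + (K : ℝ) + j ≤ C * P ^ s ∧
        2 ≤ ((j : ℝ) + 1) * a + (1 - z) - P := by
      rcases Nat.eq_or_lt_of_le hKj with h | h
      · refine ⟨K * a + η, by linarith, hKu, ?_, ?_⟩
        · rw [← h]; linarith
        · rw [← h]; rcases hηz with h | h <;> linarith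
      · refine ⟨j * a + (1 - z), ?_, ?_, pts j h hjM.le, by linarith⟩
        · have : 0 ≤ (j : ℝ) * a := by positivity
          linarith
        · by_contra hcon
          push Not at hcon
          apply hmin (j - 1) (by omega)
          refine ⟨by omega, ?_⟩
          push_cast [Nat.cast_sub (show 1 ≤ j by omega)]
          linarith
    have pQ := pts (j + 1) (by omega) hjM
    push_cast at pQ
    have hch := chord hC hs0 (by linarith) hP0 (by linarith) hPu hj hPC pQ
    set Q := ((j : ℝ) + 1) * a + (1 - z) with hQ
    set δ := Q - u with hδ
    have b1 : ∑ q ∈ Finset.range K, phi (u - ((q : ℝ) + 1) * a + (1 - z)) ≤ K := by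
      have : ∑ q ∈ Finset.range K, phi (u - ((q : ℝ) + 1) * a + (1 - z)) ≤
        ∑ q ∈ Finset.range K, (1 : ℝ) := Finset.sum_le_sum (fun q _ => phi_le_one _)
      simpa using this
    have b2 := sum_bound (fun q : ℕ => phi (u - ((q : ℝ) + 1) * a + z)) j
      (fun q => phi_le_one _) (fun q hq => by
        have hqr : (j : ℝ) + 1 ≤ q := by exact_mod_cast hq
        refine (phi_zero ?_).le
        nlinarith) M hjM
    have e2 : u - ((j : ℝ) + 1) * a + z = 1 - δ := by rw [hδ, hQ]; ring
    rw [e2] at b2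
    have hδ0 : 0 ≤ δ := by linarith
    have hfin : phi (1 - δ) ≤ 1 - δ / (Q - P) := by
      rcases le_total δ 1 with h | h
      · have := phi_le (1 - δ) (by linarith)
        have : δ / (Q - P) ≤ δ / 2 := div_le_div_of_nonneg_left hδ0 (by norm_num) hPQ
        linarith
      · rw [phi_zero (by linarith)]
        have : δ / (Q - P) ≤ 1 := by
          rw [div_le_one (by linarith)]; linarith
        linarith
    linarith

lemma key {K M : ℕ} {a z s C u : ℝ} (hM1 : 1 ≤ K + M) (ha : (K : ℝ) + M + 2 ≤ a)
    (hz0 : 0 ≤ z) (hz1 : z ≤ 1) (hs0 : 0 ≤ s) (hs1 : s ≤ 1 / 2) (hC : 0 ≤ C)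
    (h0 : 1 ≤ C * (max z (1 - z)) ^ s)
    (h1 : 1 + 2 * ((min K M : ℕ) : ℝ) ≤ C * ((min K M : ℕ) * a + max z (1 - z)) ^ s)
    (h2 : 1 + (K : ℝ) + M ≤ C * (max (K * a + z) (M * a + (1 - z))) ^ s)
    (hu0 : max z (1 - z) ≤ u) (hu1 : u ≤ max (K * a + z) (M * a + (1 - z))) :
    1 + ∑ q ∈ Finset.range K, phi (u - ((q : ℝ) + 1) * a + (1 - z)) +
      ∑ q ∈ Finset.range M, phi (u - ((q : ℝ) + 1) * a + z) ≤ C * u ^ s := by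
  rcases le_total K M with h | h
  · rw [min_eq_left h] at h1
    exact key_aux h (by omega) ha hz0 hz1 hs0 hs1 hC h0 h1 h2 hu0 hu1
  · rw [min_eq_right h] at h1
    have e : max (1 - z) (1 - (1 - z)) = max z (1 - z) := by
      rw [max_comm]; congr 1; ring
    have e2 : max (M * a + (1 - z)) (K * a + (1 - (1 - z))) =
        max (K * a + z) (M * a + (1 - z)) := by
      rw [max_comm]; congr 1; ring
    have := key_aux (K := M) (M := K) (z := 1 - z) (a := a) (s := s) (C := C) (u := u) h (by omega)
      (by linarith) (by linarith) (by linarith) hs0 hs1 hC (by rwa [e]) (by rwa [e])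
      (by rw [e2]; linarith) (by rwa [e]) (by rwa [e2])
    have e3 : 1 - (1 - z) = z := by ring
    rw [e3] at this
    linarith

section basics

variable {N : ℕ} {ρ : ℝ}

lemma rho_lt (hN : 2 ≤ N) (hρ1 : ρ ≤ 1 / (N : ℝ) ^ 2) : ρ ≤ 1 / 4 := by
  have hNr : (2 : ℝ) ≤ N := by exact_mod_cast hN
  refine hρ1.trans ?_
  apply one_div_le_one_div_of_le (by norm_num)
  nlinarith

lemma rho_mul (hN : 2 ≤ N) (hρ1 : ρ ≤ 1 / (N : ℝ) ^ 2) : ρ * (N : ℝ) ^ 2 ≤ 1 := by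
  have hNr : (2 : ℝ) ≤ N := by exact_mod_cast hN
  rwa [le_div_iff₀ (by positivity)] at hρ1

lemma R_pos (hN : 2 ≤ N) (hρ1 : ρ ≤ 1 / (N : ℝ) ^ 2) : 0 < R N ρ := by
  have hNr : (2 : ℝ) ≤ N := by exact_mod_cast hN
  have := rho_lt hN hρ1
  unfold R
  exact div_pos (by linarith) (by linarith)

lemma R_mul (hN : 2 ≤ N) : ((N : ℝ) - 1) * R N ρ = 1 - ρ := by
  have hNr : (2 : ℝ) ≤ N := by exact_mod_cast hN
  unfold R
  have : (N : ℝ) - 1 ≠ 0 := by linarith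
  field_simp

lemma a_ge (hN : 2 ≤ N) (hρ0 : 0 < ρ) (hρ1 : ρ ≤ 1 / (N : ℝ) ^ 2) : (N : ℝ) + 1 ≤ R N ρ / ρ := by
  have hNr : (2 : ℝ) ≤ N := by exact_mod_cast hN
  have h := rho_mul hN hρ1
  rw [le_div_iff₀ hρ0]
  unfold R
  rw [le_div_iff₀ (by linarith)]
  nlinarith

lemma f_eq (hρ0 : 0 < ρ) (i : ℕ) (x : ℝ) : f N ρ i x = ρ * (x + i * (R N ρ / ρ)) := by
  unfold f; field_simp

lemma meas_f (i : ℕ) : Measurable (f N ρ i) := by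
  unfold f; fun_prop

end basics

section meas

variable {N : ℕ} {ρ : ℝ} {μ : Measure ℝ}

lemma ss_apply (hss : IsSelfSimilar N ρ μ) {A : Set ℝ} (hA : MeasurableSet A) :
    μ A = ∑ i ∈ Finset.range N, (N : ℝ≥0∞)⁻¹ * μ (f N ρ i ⁻¹' A) := by
  have h : μ = _ := hss
  have h2 := congrArg (fun ν : Measure ℝ => ν A) h
  simp only [Measure.coe_finsetSum, Finset.sum_apply, Measure.smul_apply, smul_eq_mul] at h2
  rw [h2]
  refine Finset.sum_congr rfl fun i _ => ?_
  rw [Measure.map_apply (meas_f i) hA]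

lemma ss_real [IsProbabilityMeasure μ] (hss : IsSelfSimilar N ρ μ) (hN : 2 ≤ N)
    {A : Set ℝ} (hA : MeasurableSet A) :
    μ.real A = (N : ℝ)⁻¹ * ∑ i ∈ Finset.range N, μ.real (f N ρ i ⁻¹' A) := by
  unfold Measure.real
  rw [ss_apply hss hA, ENNReal.toReal_sum, Finset.mul_sum]
  · refine Finset.sum_congr rfl fun i _ => ?_
    rw [ENNReal.toReal_mul, ENNReal.toReal_inv, ENNReal.toReal_natCast]
  · intro i _
    refine ENNReal.mul_ne_top ?_ (measure_ne_top _ _)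
    simp; omega

lemma meas_refl : Measurable (fun x : ℝ => 1 - x) := by fun_prop

lemma refl_ss (hN : 2 ≤ N) (hss : IsSelfSimilar N ρ μ) :
    IsSelfSimilar N ρ (μ.map (fun x => 1 - x)) := by
  unfold IsSelfSimilar
  ext A hA
  rw [Measure.map_apply meas_refl hA, ss_apply hss (meas_refl hA), ← Finset.sum_range_reflect]
  simp only [Measure.coe_finsetSum, Finset.sum_apply, Measure.smul_apply, smul_eq_mul]
  refine Finset.sum_congr rfl fun i hi => ?_
  rw [Finset.mem_range] at hi
  rw [Measure.map_apply (meas_f i) hA, Measure.map_apply meas_refl (meas_f i hA)]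
  congr 2
  ext x
  simp only [mem_preimage]
  have : 1 - f N ρ (N - 1 - i) x = f N ρ i (1 - x) := by
    unfold f
    have h := R_mul (ρ := ρ) hN
    have e : ((N - 1 - i : ℕ) : ℝ) = N - 1 - i := by
      rw [Nat.cast_sub (by omega), Nat.cast_sub (by omega)]; simp
    rw [e]
    linarith
  rw [this]

lemma refl_prob [IsProbabilityMeasure μ] : IsProbabilityMeasure (μ.map (fun x => 1 - x)) :=
  Measure.isProbabilityMeasure_map meas_refl.aemeasurable

lemma real_le_one [IsProbabilityMeasure μ] (A : Set ℝ) : μ.real A ≤ 1 := measureReal_le_one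

lemma neg_step [IsProbabilityMeasure μ] (hN : 2 ≤ N) (hρ0 : 0 < ρ) (hρ1 : ρ ≤ 1 / (N : ℝ) ^ 2)
    (hss : IsSelfSimilar N ρ μ) (c : ℝ) :
    μ.real (Iio (-c)) ≤ μ.real (Iio (-(c / ρ))) := by
  have hNr : (2 : ℝ) ≤ N := by exact_mod_cast hN
  have hR := R_pos hN hρ1
  rw [ss_real hss hN measurableSet_Iio]
  have : ∑ i ∈ Finset.range N, μ.real (f N ρ i ⁻¹' Iio (-c)) ≤
      ∑ i ∈ Finset.range N, μ.real (Iio (-(c / ρ))) := by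
    refine Finset.sum_le_sum fun i _ => measureReal_mono ?_
    intro x hx
    simp only [mem_preimage, mem_Iio, f] at hx ⊢
    have : 0 ≤ (i : ℝ) * R N ρ := by positivity
    rw [← neg_div, lt_div_iff₀ hρ0]
    linarith
  rw [Finset.sum_const, Finset.card_range, nsmul_eq_mul] at this
  rw [inv_mul_le_iff₀ (by linarith)]
  exact this

lemma neg_null [IsProbabilityMeasure μ] (hN : 2 ≤ N) (hρ0 : 0 < ρ) (hρ1 : ρ ≤ 1 / (N : ℝ) ^ 2)
    (hss : IsSelfSimilar N ρ μ) : μ (Iio 0) = 0 := by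
  have h1 : ∀ c : ℝ, 0 < c → μ (Iio (-c)) = 0 := by
    intro c hc
    have hn : ∀ n : ℕ, μ.real (Iio (-c)) ≤ μ.real (Iio (-(c / ρ ^ n))) := by
      intro n
      induction n with
      | zero => simp
      | succ n ih =>
        refine ih.trans ((neg_step hN hρ0 hρ1 hss _).trans_eq ?_)
        rw [div_div, pow_succ]
    have hlim : Tendsto (fun n : ℕ => -(c / ρ ^ n)) atTop atBot := by
      apply tendsto_neg_atTop_atBot.comp
      have : (fun n : ℕ => c / ρ ^ n) = fun n : ℕ => c * (ρ⁻¹) ^ n := by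
        ext n; rw [inv_pow]; rfl
      rw [this]
      refine Tendsto.const_mul_atTop hc (tendsto_pow_atTop_atTop_of_one_lt ?_)
      have := rho_lt hN hρ1
      exact (one_lt_inv₀ hρ0).2 (by linarith)
    have h2 : Tendsto (fun n : ℕ => μ.real (Iio (-(c / ρ ^ n)))) atTop (𝓝 0) := by
      have h := (tendsto_measure_Ici_atBot μ).comp hlim
      have h' := (ENNReal.tendsto_toReal (measure_ne_top μ univ)).comp h
      have h'' := h'.const_sub 1
      simp only [measure_univ, ENNReal.toReal_one, sub_self] at h''
      refine h''.congr fun n => ?_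
      have := probReal_compl_eq_one_sub (μ := μ) (s := Ici (-(c / ρ ^ n))) measurableSet_Ici
      rw [compl_Ici] at this
      rw [this]; rfl
    have h3 : μ.real (Iio (-c)) ≤ 0 :=
      ge_of_tendsto h2 (Eventually.of_forall fun n => hn n)
    have h4 : μ.real (Iio (-c)) = 0 := le_antisymm h3 measureReal_nonneg
    exact (measureReal_eq_zero_iff).1 h4
  have h5 : Iio (0 : ℝ) ⊆ ⋃ n : ℕ, Iio (-(1 / ((n : ℝ) + 1))) := by
    intro x hx
    obtain ⟨n, hn⟩ := exists_nat_one_div_lt (show 0 < -x by simpa using hx)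
    exact mem_iUnion.2 ⟨n, by simp only [mem_Iio]; linarith⟩
  refine measure_mono_null h5 (measure_iUnion_null fun n => h1 _ (by positivity))

lemma Ioi_null [IsProbabilityMeasure μ] (hN : 2 ≤ N) (hρ0 : 0 < ρ) (hρ1 : ρ ≤ 1 / (N : ℝ) ^ 2)
    (hss : IsSelfSimilar N ρ μ) : μ (Ioi 1) = 0 := by
  have := refl_prob (μ := μ)
  have := neg_null hN hρ0 hρ1 (refl_ss hN hss)
  rw [Measure.map_apply meas_refl measurableSet_Iio] at this
  refine measure_mono_null ?_ this
  intro x hx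
  simp only [mem_Ioi, mem_preimage, mem_Iio] at hx ⊢
  linarith

lemma full [IsProbabilityMeasure μ] (hN : 2 ≤ N) (hρ0 : 0 < ρ) (hρ1 : ρ ≤ 1 / (N : ℝ) ^ 2)
    (hss : IsSelfSimilar N ρ μ) {A : Set ℝ} (hA : Icc 0 1 ⊆ A) : μ.real A = 1 := by
  have h : μ Aᶜ = 0 := by
    refine measure_mono_null (t := Iio 0 ∪ Ioi 1) ?_
      (measure_union_null (neg_null hN hρ0 hρ1 hss) (Ioi_null hN hρ0 hρ1 hss))
    intro x hx
    by_contra hcon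
    simp only [mem_union, mem_Iio, mem_Ioi, not_or, not_lt] at hcon
    exact hx (hA hcon)
  have : μ A = 1 := by
    have h2 : μ univ ≤ μ A + μ Aᶜ := by
      rw [← union_compl_self A]; exact measure_union_le _ _
    rw [h, add_zero, measure_univ] at h2
    exact le_antisymm prob_le_one h2
  simp [Measure.real, this]

lemma low [IsProbabilityMeasure μ] (hN : 2 ≤ N) (hρ0 : 0 < ρ) (hρ1 : ρ ≤ 1 / (N : ℝ) ^ 2)
    (hss : IsSelfSimilar N ρ μ) {δ : ℝ} (h0 : 0 ≤ δ) (h1 : δ ≤ 1) : δ / 2 ≤ μ.real (Iic δ) := by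
  have hNr : (2 : ℝ) ≤ N := by exact_mod_cast hN
  have hR := R_pos hN hρ1
  have hRm := R_mul (ρ := ρ) hN
  have hrm := rho_mul hN hρ1
  have hr4 := rho_lt hN hρ1
  have cell : ∀ i : ℕ, i < N → ∀ δ : ℝ, i * R N ρ + ρ ≤ δ → ((i : ℝ) + 1) / N ≤ μ.real (Iic δ) := by
    intro i hi δ hδ
    rw [ss_real hss hN measurableSet_Iic]
    have : ((i : ℝ) + 1) ≤ ∑ l ∈ Finset.range N, μ.real (f N ρ l ⁻¹' Iic δ) := by
      calc ((i : ℝ) + 1) = ∑ l ∈ Finset.range (i + 1), (1 : ℝ) := by simp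
        _ = ∑ l ∈ Finset.range (i + 1), μ.real (f N ρ l ⁻¹' Iic δ) := by
          refine Finset.sum_congr rfl fun l hl => ?_
          rw [Finset.mem_range] at hl
          refine (full hN hρ0 hρ1 hss ?_).symm
          intro x hx
          simp only [mem_preimage, mem_Iic, f]
          have hli : (l : ℝ) ≤ i := by exact_mod_cast (show l ≤ i by omega)
          have := mul_le_mul_of_nonneg_right hli hR.le
          have := mul_le_mul_of_nonneg_left hx.2 hρ0.le
          linarith
        _ ≤ _ := Finset.sum_le_sum_of_subset_of_nonneg
          (Finset.range_mono (by omega)) (fun _ _ _ => measureReal_nonneg)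
    rw [div_eq_inv_mul]
    exact mul_le_mul_of_nonneg_left this (by positivity)
  have hRρ : N * (R N ρ + ρ) ≤ 2 := by
    have hm : ((N : ℝ) - 1) * (R N ρ + ρ) = 1 + (N - 2) * ρ := by linarith
    have h3 : ((N : ℝ) - 1) * (N * (R N ρ + ρ)) ≤ (N - 1) * 2 := by
      have : N * (1 + (N - 2) * ρ) ≤ ((N : ℝ) - 1) * 2 := by
        refine le_of_mul_le_mul_left ?_ (show (0 : ℝ) < N by linarith)
        nlinarith [mul_le_mul_of_nonneg_left hrm (show (0 : ℝ) ≤ N - 2 by linarith),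
          mul_nonneg (show (0 : ℝ) ≤ N - 1 by linarith) (show (0 : ℝ) ≤ N - 2 by linarith)]
      nlinarith
    exact le_of_mul_le_mul_left h3 (by linarith)
  have hind : ∀ n : ℕ, ∀ δ : ℝ, ρ ^ n ≤ δ → δ ≤ 1 → δ / 2 ≤ μ.real (Iic δ) := by
    intro n
    induction n with
    | zero =>
      intro δ h h'
      have : μ.real (Iic δ) = 1 := full hN hρ0 hρ1 hss (fun x hx => by
        simp at h; exact hx.2.trans h)
      rw [this]; linarith
    | succ n ih =>
      intro δ h h'
      rcases le_total ρ δ with hc | hc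
      · set i := ⌊(δ - ρ) / R N ρ⌋₊ with hi
        have hi1 : (i : ℝ) ≤ (δ - ρ) / R N ρ := Nat.floor_le (div_nonneg (by linarith) hR.le)
        have hi2 : (δ - ρ) / R N ρ < i + 1 := Nat.lt_floor_add_one _
        rw [le_div_iff₀ hR] at hi1
        rw [div_lt_iff₀ hR] at hi2
        have hiN : i < N := by
          by_contra hcon
          push Not at hcon
          have : (N : ℝ) ≤ i := by exact_mod_cast hcon
          nlinarith
        refine le_trans ?_ (cell i hiN δ (by linarith))
        rw [div_le_div_iff₀ (by norm_num) (by linarith)]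
        have hi0 : (0 : ℝ) ≤ i := by positivity
        have hb : δ ≤ (i + 1) * (R N ρ + ρ) := by nlinarith
        calc δ * N ≤ (i + 1) * (R N ρ + ρ) * N := mul_le_mul_of_nonneg_right hb (by linarith)
          _ = (i + 1) * (N * (R N ρ + ρ)) := by ring
          _ ≤ (i + 1) * 2 := mul_le_mul_of_nonneg_left hRρ (by linarith)
      · have hih := ih (δ / ρ) (by rw [le_div_iff₀ hρ0, ← pow_succ]; exact h)
          (by rw [div_le_one hρ0]; exact hc)
        rw [ss_real hss hN measurableSet_Iic]
        have hle : μ.real (f N ρ 0 ⁻¹' Iic δ) ≤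
            ∑ l ∈ Finset.range N, μ.real (f N ρ l ⁻¹' Iic δ) :=
          Finset.single_le_sum (f := fun l => μ.real (f N ρ l ⁻¹' Iic δ))
            (fun _ _ => measureReal_nonneg) (Finset.mem_range.2 (by omega))
        have e : f N ρ 0 ⁻¹' Iic δ = Iic (δ / ρ) := by
          ext x
          simp [f, le_div_iff₀ hρ0, mul_comm]
        rw [e] at hle
        have hδ0 : 0 ≤ δ := le_trans (by positivity) h
        have hNρ : (N : ℝ) * ρ ≤ 1 := by nlinarith
        rw [le_inv_mul_iff₀ (by linarith)]
        refine le_trans ?_ (hih.trans hle)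
        rw [div_div, ← mul_div_assoc, div_le_div_iff₀ (by norm_num) (by positivity)]
        nlinarith
  rcases h0.eq_or_lt with h | h
  · rw [← h]; simp
  · obtain ⟨n, hn⟩ := exists_pow_lt_of_lt_one h (show ρ < 1 by linarith)
    exact hind n δ hn.le h1

lemma Iio_le_phi [IsProbabilityMeasure μ] (hN : 2 ≤ N) (hρ0 : 0 < ρ) (hρ1 : ρ ≤ 1 / (N : ℝ) ^ 2)
    (hss : IsSelfSimilar N ρ μ) (v : ℝ) : μ.real (Iio v) ≤ phi v := by
  unfold phi
  split_ifs with hv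
  · have : μ (Iio v) = 0 := measure_mono_null (Iio_subset_Iio hv) (neg_null hN hρ0 hρ1 hss)
    simp [Measure.real, this]
  · push Not at hv
    refine le_min (real_le_one _) ?_
    rcases le_total 1 v with h | h
    · have := real_le_one (μ := μ) (Iio v)
      linarith
    · have := refl_prob (μ := μ)
      have hl := low hN hρ0 hρ1 (refl_ss hN hss) (δ := 1 - v) (by linarith) (by linarith)
      have e : (fun x : ℝ => 1 - x) ⁻¹' Iic (1 - v) = Ici v := by
        ext x; simp
      rw [Measure.real, Measure.map_apply meas_refl measurableSet_Iic, e, ← Measure.real,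
        ← compl_Iio, probReal_compl_eq_one_sub measurableSet_Iio] at hl
      linarith

lemma Ioi_le_phi [IsProbabilityMeasure μ] (hN : 2 ≤ N) (hρ0 : 0 < ρ) (hρ1 : ρ ≤ 1 / (N : ℝ) ^ 2)
    (hss : IsSelfSimilar N ρ μ) (v : ℝ) : μ.real (Ioi (1 - v)) ≤ phi v := by
  have := refl_prob (μ := μ)
  have hl := Iio_le_phi hN hρ0 hρ1 (refl_ss hN hss) v
  have e : (fun x : ℝ => 1 - x) ⁻¹' Iio v = Ioi (1 - v) := by
    ext x
    simp only [mem_preimage, mem_Iio, mem_Ioi]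
    constructor <;> intro h <;> linarith
  rwa [Measure.real, Measure.map_apply meas_refl measurableSet_Iio, e, ← Measure.real] at hl

lemma pre_ball (hρ0 : 0 < ρ) (i k : ℕ) (z u : ℝ) :
    f N ρ i ⁻¹' Ioo (f N ρ k z - ρ * u) (f N ρ k z + ρ * u) =
      Ioo (z + ((k : ℝ) - i) * (R N ρ / ρ) - u) (z + ((k : ℝ) - i) * (R N ρ / ρ) + u) := by
  ext x
  simp only [mem_preimage, mem_Ioo, f_eq hρ0, ← mul_sub, ← mul_add, mul_lt_mul_iff_right₀ hρ0]
  constructor <;> rintro ⟨h1, h2⟩ <;> constructor <;> linarith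

lemma ball_sum [IsProbabilityMeasure μ] (hN : 2 ≤ N) (hρ0 : 0 < ρ)
    (hss : IsSelfSimilar N ρ μ) (k : ℕ) (z u : ℝ) :
    μ.real (Ioo (f N ρ k z - ρ * u) (f N ρ k z + ρ * u)) = (N : ℝ)⁻¹ *
      ∑ i ∈ Finset.range N, μ.real (Ioo (z + ((k : ℝ) - i) * (R N ρ / ρ) - u)
        (z + ((k : ℝ) - i) * (R N ρ / ρ) + u)) := by
  rw [ss_real hss hN measurableSet_Ioo]
  simp only [pre_ball hρ0]

lemma step_eq [IsProbabilityMeasure μ] (hN : 2 ≤ N) (hρ0 : 0 < ρ) (hρ1 : ρ ≤ 1 / (N : ℝ) ^ 2)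
    (hss : IsSelfSimilar N ρ μ) {k : ℕ} (hk : k < N) {z t : ℝ} (hz0 : 0 ≤ z) (hz1 : z ≤ 1)
    (ht : t ≤ 1) :
    μ.real (Ioo (f N ρ k z - ρ * t) (f N ρ k z + ρ * t)) =
      (N : ℝ)⁻¹ * μ.real (Ioo (z - t) (z + t)) := by
  have hNr : (2 : ℝ) ≤ N := by exact_mod_cast hN
  have ha := a_ge hN hρ0 hρ1
  rw [ball_sum hN hρ0 hss]
  congr 1
  rw [Finset.sum_eq_single k]
  · simp
  · intro i _ hik
    have : μ (Ioo (z + ((k : ℝ) - i) * (R N ρ / ρ) - t) (z + ((k : ℝ) - i) * (R N ρ / ρ) + t))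
        = 0 := by
      rcases Nat.lt_or_ge i k with h | h
      · have : (i : ℝ) + 1 ≤ k := by exact_mod_cast h
        refine measure_mono_null ?_ (Ioi_null hN hρ0 hρ1 hss)
        intro x hx
        have := hx.1
        simp only [mem_Ioi]
        nlinarith
      · have : (k : ℝ) + 1 ≤ i := by exact_mod_cast (show k + 1 ≤ i by omega)
        refine measure_mono_null ?_ (neg_null hN hρ0 hρ1 hss)
        intro x hx
        have := hx.2
        simp only [mem_Iio]
        nlinarith
    simp [Measure.real, this]
  · intro h; exact absurd (Finset.mem_range.2 hk) h

lemma step_le [IsProbabilityMeasure μ] (hN : 2 ≤ N) (hρ0 : 0 < ρ)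
    (hss : IsSelfSimilar N ρ μ) {k : ℕ} (hk : k < N) (z t : ℝ) :
    (N : ℝ)⁻¹ * μ.real (Ioo (z - t) (z + t)) ≤
      μ.real (Ioo (f N ρ k z - ρ * t) (f N ρ k z + ρ * t)) := by
  rw [ball_sum hN hρ0 hss]
  refine mul_le_mul_of_nonneg_left ?_ (by positivity)
  have := Finset.single_le_sum (s := Finset.range N)
    (f := fun i : ℕ => μ.real (Ioo (z + ((k : ℝ) - i) * (R N ρ / ρ) - t)
      (z + ((k : ℝ) - i) * (R N ρ / ρ) + t)))
    (fun _ _ => measureReal_nonneg) (Finset.mem_range.2 hk)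
  simpa using this

lemma level_upper [IsProbabilityMeasure μ] (hN : 2 ≤ N) (hρ0 : 0 < ρ) (hρ1 : ρ ≤ 1 / (N : ℝ) ^ 2)
    (hss : IsSelfSimilar N ρ μ) {k : ℕ} (hk : k < N) (z u : ℝ) :
    N * μ.real (Ioo (f N ρ k z - ρ * u) (f N ρ k z + ρ * u)) ≤
      1 + ∑ q ∈ Finset.range k, phi (u - ((q : ℝ) + 1) * (R N ρ / ρ) + (1 - z)) +
      ∑ q ∈ Finset.range (N - 1 - k), phi (u - ((q : ℝ) + 1) * (R N ρ / ρ) + z) := by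
  have hNr : (2 : ℝ) ≤ N := by exact_mod_cast hN
  rw [ball_sum hN hρ0 hss, mul_inv_cancel_left₀ (by linarith)]
  set a := R N ρ / ρ
  obtain ⟨M, rfl⟩ : ∃ M, N = k + 1 + M := ⟨N - 1 - k, by omega⟩
  have e : k + 1 + M - 1 - k = M := by omega
  rw [e, Finset.sum_range_add, Finset.sum_range_succ, ← Finset.sum_range_reflect]
  have h1 : ∑ j ∈ Finset.range k, μ.real (Ioo (z + ((k : ℝ) - (k - 1 - j : ℕ)) * a - u)
      (z + ((k : ℝ) - (k - 1 - j : ℕ)) * a + u)) ≤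
      ∑ q ∈ Finset.range k, phi (u - ((q : ℝ) + 1) * a + (1 - z)) := by
    refine Finset.sum_le_sum fun q hq => ?_
    rw [Finset.mem_range] at hq
    refine le_trans (measureReal_mono ?_) (Ioi_le_phi hN hρ0 hρ1 hss _)
    intro x hx
    have := hx.1
    rw [Nat.cast_sub (by omega), Nat.cast_sub (by omega)] at this
    push_cast at this
    simp only [mem_Ioi]
    linarith
  have h2 : ∑ q ∈ Finset.range M, μ.real (Ioo (z + ((k : ℝ) - (k + 1 + q : ℕ)) * a - u)
      (z + ((k : ℝ) - (k + 1 + q : ℕ)) * a + u)) ≤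
      ∑ q ∈ Finset.range M, phi (u - ((q : ℝ) + 1) * a + z) := by
    refine Finset.sum_le_sum fun q hq => ?_
    refine le_trans (measureReal_mono ?_) (Iio_le_phi hN hρ0 hρ1 hss _)
    intro x hx
    have := hx.2
    push_cast at this
    simp only [mem_Iio]
    linarith
  have h3 := real_le_one (μ := μ) (Ioo (z + ((k : ℝ) - k) * a - u) (z + ((k : ℝ) - k) * a + u))
  linarith

lemma level_lower [IsProbabilityMeasure μ] (hN : 2 ≤ N) (hρ0 : 0 < ρ) (hρ1 : ρ ≤ 1 / (N : ℝ) ^ 2)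
    (hss : IsSelfSimilar N ρ μ) {k j : ℕ} (hjk : j ≤ k) (hjN : k + j < N) {z u : ℝ}
    (hu : j * (R N ρ / ρ) + max z (1 - z) < u) :
    (N : ℝ)⁻¹ * (1 + 2 * j) ≤ μ.real (Ioo (f N ρ k z - ρ * u) (f N ρ k z + ρ * u)) := by
  have hNr : (2 : ℝ) ≤ N := by exact_mod_cast hN
  have ha := a_ge hN hρ0 hρ1
  have hz1 := le_max_left z (1 - z)
  have hz2 := le_max_right z (1 - z)
  rw [ball_sum hN hρ0 hss]
  refine mul_le_mul_of_nonneg_left ?_ (by positivity)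
  set a := R N ρ / ρ
  have hsub : Finset.Icc (k - j) (k + j) ⊆ Finset.range N := by
    intro i hi
    rw [Finset.mem_Icc] at hi
    exact Finset.mem_range.2 (by omega)
  refine le_trans ?_ (Finset.sum_le_sum_of_subset_of_nonneg hsub (fun _ _ _ => measureReal_nonneg))
  have : ∀ i ∈ Finset.Icc (k - j) (k + j), μ.real (Ioo (z + ((k : ℝ) - i) * a - u)
      (z + ((k : ℝ) - i) * a + u)) = 1 := by
    intro i hi
    rw [Finset.mem_Icc] at hi
    have h1 : (k : ℝ) ≤ i + j := by exact_mod_cast (show k ≤ i + j by omega)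
    have h2 : (i : ℝ) ≤ k + j := by exact_mod_cast hi.2
    refine full hN hρ0 hρ1 hss ?_
    intro x hx
    have := hx.1
    have := hx.2
    constructor
    · nlinarith
    · nlinarith
  rw [Finset.sum_congr rfl this, Finset.sum_const, Nat.card_Icc, nsmul_eq_mul, mul_one]
  have e : k + j + 1 - (k - j) = 1 + 2 * j := by omega
  rw [e]; push_cast; exact le_rfl

end meas

section coding

variable {N : ℕ} {ρ : ℝ}

lemma summ (hN : 2 ≤ N) (hρ0 : 0 < ρ) (hρ1 : ρ ≤ 1 / (N : ℝ) ^ 2) {d : ℕ → ℕ} (hd : ∀ i, d i < N) :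
    Summable (fun i : ℕ => (d i : ℝ) * ρ ^ i) := by
  have hr := rho_lt hN hρ1
  refine Summable.of_nonneg_of_le (fun i => by positivity) (fun i => ?_)
    ((summable_geometric_of_lt_one hρ0.le (show ρ < 1 by linarith)).mul_left (N : ℝ))
  refine mul_le_mul_of_nonneg_right ?_ (by positivity)
  exact_mod_cast (hd i).le

lemma piMap_nonneg (hN : 2 ≤ N) (hρ0 : 0 < ρ) (hρ1 : ρ ≤ 1 / (N : ℝ) ^ 2) (d : ℕ → ℕ) :
    0 ≤ piMap N ρ d := by
  unfold piMap
  exact mul_nonneg (R_pos hN hρ1).le (tsum_nonneg fun i => by positivity)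

lemma piMap_le_one (hN : 2 ≤ N) (hρ0 : 0 < ρ) (hρ1 : ρ ≤ 1 / (N : ℝ) ^ 2) {d : ℕ → ℕ}
    (hd : ∀ i, d i < N) : piMap N ρ d ≤ 1 := by
  have hr := rho_lt hN hρ1
  have hg := summable_geometric_of_lt_one hρ0.le (show ρ < 1 by linarith)
  have h : ∑' i : ℕ, (d i : ℝ) * ρ ^ i ≤ ((N : ℝ) - 1) * (1 - ρ)⁻¹ := by
    rw [← tsum_geometric_of_lt_one hρ0.le (show ρ < 1 by linarith), ← tsum_mul_left]
    refine Summable.tsum_le_tsum (fun i => ?_) (summ hN hρ0 hρ1 hd) (hg.mul_left _)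
    refine mul_le_mul_of_nonneg_right ?_ (by positivity)
    have : (d i : ℝ) + 1 ≤ N := by exact_mod_cast hd i
    linarith
  unfold piMap
  refine (mul_le_mul_of_nonneg_left h (R_pos hN hρ1).le).trans ?_
  rw [← mul_assoc, mul_comm (R N ρ), R_mul hN, mul_inv_cancel₀ (by linarith)]

lemma piMap_eq (hN : 2 ≤ N) (hρ0 : 0 < ρ) (hρ1 : ρ ≤ 1 / (N : ℝ) ^ 2) {d : ℕ → ℕ}
    (hd : ∀ i, d i < N) : piMap N ρ d = f N ρ (d 0) (piMap N ρ (fun i => d (1 + i))) := by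
  unfold piMap f
  rw [(summ hN hρ0 hρ1 hd).tsum_eq_zero_add]
  have : ∑' b : ℕ, (d (b + 1) : ℝ) * ρ ^ (b + 1) = ρ * ∑' i : ℕ, (d (1 + i) : ℝ) * ρ ^ i := by
    rw [← tsum_mul_left]
    refine tsum_congr fun b => ?_
    rw [add_comm 1 b]; ring
  rw [this]; ring

lemma Tn_eq (hN : 2 ≤ N) (hρ0 : 0 < ρ) (hρ1 : ρ ≤ 1 / (N : ℝ) ^ 2) {d : ℕ → ℕ}
    (hd : ∀ i, d i < N) (n : ℕ) : Tn N ρ d n = f N ρ (d n) (Tn N ρ d (n + 1)) := by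
  unfold Tn
  rw [piMap_eq hN hρ0 hρ1 (fun i => hd (n + i))]
  simp only [add_zero, add_assoc]

lemma Tn_zero (d : ℕ → ℕ) : Tn N ρ d 0 = piMap N ρ d := by
  unfold Tn; simp

lemma Tn_nonneg (hN : 2 ≤ N) (hρ0 : 0 < ρ) (hρ1 : ρ ≤ 1 / (N : ℝ) ^ 2) (d : ℕ → ℕ) (n : ℕ) :
    0 ≤ Tn N ρ d n := piMap_nonneg hN hρ0 hρ1 _

lemma Tn_le_one (hN : 2 ≤ N) (hρ0 : 0 < ρ) (hρ1 : ρ ≤ 1 / (N : ℝ) ^ 2) {d : ℕ → ℕ}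
    (hd : ∀ i, d i < N) (n : ℕ) : Tn N ρ d n ≤ 1 :=
  piMap_le_one hN hρ0 hρ1 (fun i => hd (n + i))

variable {μ : Measure ℝ}

lemma scale_eq [IsProbabilityMeasure μ] (hN : 2 ≤ N) (hρ0 : 0 < ρ) (hρ1 : ρ ≤ 1 / (N : ℝ) ^ 2)
    (hss : IsSelfSimilar N ρ μ) {d : ℕ → ℕ} (hd : ∀ i, d i < N) (n : ℕ) :
    ∀ t : ℝ, 0 ≤ t → t ≤ 1 →
    μ.real (Ioo (piMap N ρ d - ρ ^ n * t) (piMap N ρ d + ρ ^ n * t)) =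
      ((N : ℝ)⁻¹) ^ n * μ.real (Ioo (Tn N ρ d n - t) (Tn N ρ d n + t)) := by
  have hr := rho_lt hN hρ1
  induction n with
  | zero => intro t _ _; simp [Tn_zero]
  | succ n ih =>
    intro t ht0 ht1
    rw [pow_succ, mul_assoc, ih (ρ * t) (by positivity) (by nlinarith), Tn_eq hN hρ0 hρ1 hd,
      step_eq hN hρ0 hρ1 hss (hd n) (Tn_nonneg hN hρ0 hρ1 _ _)
        (Tn_le_one hN hρ0 hρ1 hd _) ht1]
    ring

lemma scale_le [IsProbabilityMeasure μ] (hN : 2 ≤ N) (hρ0 : 0 < ρ) (hρ1 : ρ ≤ 1 / (N : ℝ) ^ 2)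
    (hss : IsSelfSimilar N ρ μ) {d : ℕ → ℕ} (hd : ∀ i, d i < N) (n : ℕ) :
    ∀ t : ℝ, ((N : ℝ)⁻¹) ^ n * μ.real (Ioo (Tn N ρ d n - t) (Tn N ρ d n + t)) ≤
      μ.real (Ioo (piMap N ρ d - ρ ^ n * t) (piMap N ρ d + ρ ^ n * t)) := by
  induction n with
  | zero => intro t; simp [Tn_zero]
  | succ n ih =>
    intro t
    have h := ih (ρ * t)
    rw [Tn_eq hN hρ0 hρ1 hd] at h
    have h2 := mul_le_mul_of_nonneg_left (step_le hN hρ0 hss (hd n) (Tn N ρ d (n + 1)) t)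
      (show 0 ≤ ((N : ℝ)⁻¹) ^ n by positivity)
    rw [pow_succ, mul_assoc, pow_succ, mul_assoc]
    exact h2.trans h

end coding

section final

variable {N : ℕ} {ρ : ℝ} {s : ℝ}

/-- `η_n(x) = max (T^n x) (1 - T^n x)`. -/
noncomputable def eta (N : ℕ) (ρ : ℝ) (d : ℕ → ℕ) (n : ℕ) : ℝ :=
  max (Tn N ρ d n) (1 - Tn N ρ d n)

lemma eta_ge (d : ℕ → ℕ) (n : ℕ) : 1 / 2 ≤ eta N ρ d n := by
  unfold eta
  have h1 := le_max_left (Tn N ρ d n) (1 - Tn N ρ d n)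
  have h2 := le_max_right (Tn N ρ d n) (1 - Tn N ρ d n)
  linarith

lemma eta_le (hN : 2 ≤ N) (hρ0 : 0 < ρ) (hρ1 : ρ ≤ 1 / (N : ℝ) ^ 2) {d : ℕ → ℕ}
    (hd : ∀ i, d i < N) (n : ℕ) : eta N ρ d n ≤ 1 := by
  unfold eta
  have h1 := Tn_nonneg hN hρ0 hρ1 d n
  have h2 := Tn_le_one hN hρ0 hρ1 hd n
  exact max_le h2 (by linarith)

lemma s_bounds (hN : 2 ≤ N) (hρ0 : 0 < ρ) (hρ1 : ρ ≤ 1 / (N : ℝ) ^ 2)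
    (hs : s = -Real.log N / Real.log ρ) : 0 ≤ s ∧ s ≤ 1 / 2 ∧ ρ ^ s = (N : ℝ)⁻¹ := by
  have hNr : (2 : ℝ) ≤ N := by exact_mod_cast hN
  have hr := rho_lt hN hρ1
  have hlN : 0 < Real.log N := Real.log_pos (by linarith)
  have hlρ : Real.log ρ < 0 := Real.log_neg hρ0 (by linarith)
  have hle : Real.log ρ ≤ -(2 * Real.log N) := by
    have := Real.log_le_log hρ0 hρ1
    rw [one_div, Real.log_inv, Real.log_pow] at this
    simpa using this
  refine ⟨?_, ?_, ?_⟩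
  · rw [hs]; exact div_nonneg_of_nonpos (by linarith) hlρ.le
  · rw [hs, div_le_iff_of_neg hlρ]; linarith
  · rw [Real.rpow_def_of_pos hρ0, hs, mul_div_cancel₀ _ hlρ.ne, Real.exp_neg,
      Real.exp_log (by linarith)]

variable {μ : Measure ℝ}

/-- the upper bound at one level -/
lemma upper_level [IsProbabilityMeasure μ] (hN : 2 ≤ N) (hρ0 : 0 < ρ) (hρ1 : ρ ≤ 1 / (N : ℝ) ^ 2)
    (hs : s = -Real.log N / Real.log ρ)
    (hss : IsSelfSimilar N ρ μ) {d : ℕ → ℕ} (hd : ∀ i, d i < N) (n : ℕ) {c t : ℝ}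
    (h0 : 1 / ((2 : ℝ) ^ s * eta N ρ d (n + 1) ^ s) ≤ c)
    (h2 : 1 / ((2 : ℝ) ^ s * eta N ρ d n ^ s) ≤ c)
    (h1 : (1 + 2 * ((min (d n) (N - 1 - d n) : ℕ) : ℝ)) /
            ((2 : ℝ) ^ s * (((min (d n) (N - 1 - d n) : ℕ) : ℝ) * R N ρ / ρ +
                eta N ρ d (n + 1)) ^ s) ≤ c)
    (ht0 : ρ * eta N ρ d (n + 1) ≤ t) (ht1 : t ≤ eta N ρ d n) :
    μ.real (Ioo (piMap N ρ d - ρ ^ n * t) (piMap N ρ d + ρ ^ n * t)) / (2 * (ρ ^ n * t)) ^ s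
      ≤ c := by
  have hNr : (2 : ℝ) ≤ N := by exact_mod_cast hN
  obtain ⟨hs0, hs1, hρs⟩ := s_bounds hN hρ0 hρ1 hs
  have ha := a_ge hN hρ0 hρ1
  have hR := R_pos hN hρ1
  have hRm := R_mul (ρ := ρ) hN
  have he1 := eta_ge (N := N) (ρ := ρ) d (n + 1)
  have he0 := eta_ge (N := N) (ρ := ρ) d n
  have he0' := eta_le hN hρ0 hρ1 hd n
  have hk := hd n
  have htp : 0 < t := lt_of_lt_of_le (by positivity) ht0
  have hc : 0 ≤ c := le_trans (by positivity) h0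
  have h2s : (0 : ℝ) < 2 ^ s := by positivity
  have hTz := Tn_eq hN hρ0 hρ1 hd n
  have hM : ((N - 1 - d n : ℕ) : ℝ) = N - 1 - d n := by
    rw [Nat.cast_sub (by omega), Nat.cast_sub (by omega)]; simp
  have hL : max ((d n : ℝ) * (R N ρ / ρ) + Tn N ρ d (n + 1))
      (((N - 1 - d n : ℕ) : ℝ) * (R N ρ / ρ) + (1 - Tn N ρ d (n + 1))) = eta N ρ d n / ρ := by
    unfold eta
    rw [← max_div_div_right hρ0.le]
    congr 1
    · rw [hTz]; unfold f; field_simp; ring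
    · rw [hTz, hM]; unfold f
      rw [eq_div_iff hρ0.ne']
      have : R N ρ / ρ * ρ = R N ρ := div_mul_cancel₀ _ hρ0.ne'
      calc _ = ((N : ℝ) - 1 - d n) * (R N ρ / ρ * ρ) + (1 - Tn N ρ d (n + 1)) * ρ := by ring
        _ = _ := by rw [this]; linarith
  have hdivs : ∀ y : ℝ, 0 ≤ y → (y / ρ) ^ s = y ^ s * N := by
    intro y hy
    rw [Real.div_rpow hy hρ0.le, hρs, div_inv_eq_mul]
  have hkey := key (K := d n) (M := N - 1 - d n) (a := R N ρ / ρ) (z := Tn N ρ d (n + 1))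
    (s := s) (C := c * 2 ^ s) (u := t / ρ) (by omega) (by rw [hM]; linarith)
    (Tn_nonneg hN hρ0 hρ1 _ _) (Tn_le_one hN hρ0 hρ1 hd _) hs0 hs1 (by positivity)
    (by
      rw [div_le_iff₀ (by positivity)] at h0
      rw [mul_assoc]; exact h0)
    (by
      rw [div_le_iff₀ (by positivity), mul_div_assoc] at h1
      rw [mul_assoc]; exact h1)
    (by
      rw [hL, hdivs _ (by linarith), hM]
      rw [div_le_iff₀ (by positivity)] at h2
      nlinarith)
    (by rw [le_div_iff₀ hρ0]; unfold eta at ht0; linarith)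
    (by rw [hL]; exact div_le_div_of_nonneg_right ht1 hρ0.le)
  have hup := (level_upper hN hρ0 hρ1 hss hk (Tn N ρ d (n + 1)) (t / ρ)).trans hkey
  rw [← hTz, mul_div_cancel₀ _ hρ0.ne', hdivs _ htp.le] at hup
  rw [scale_eq hN hρ0 hρ1 hss hd n t htp.le (by linarith),
    Real.mul_rpow (by norm_num) (by positivity), Real.mul_rpow (by positivity) htp.le,
    ← Real.rpow_natCast ρ n, ← Real.rpow_mul hρ0.le, mul_comm (n : ℝ) s, Real.rpow_mul hρ0.le, hρs,
    Real.rpow_natCast]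
  have hm : μ.real (Ioo (Tn N ρ d n - t) (Tn N ρ d n + t)) ≤ c * 2 ^ s * t ^ s := by
    refine le_of_mul_le_mul_left ?_ (show (0 : ℝ) < N by linarith)
    linarith
  have hNp : 0 < ((N : ℝ)⁻¹) ^ n := by positivity
  rw [div_le_iff₀ (by positivity)]
  have := mul_le_mul_of_nonneg_left hm hNp.le
  linarith

lemma covering (hN : 2 ≤ N) (hρ0 : 0 < ρ) (hρ1 : ρ ≤ 1 / (N : ℝ) ^ 2) {d : ℕ → ℕ}
    (hd : ∀ i, d i < N) (K : ℕ) : ∀ᶠ r in 𝓝[>] (0 : ℝ), ∃ n ≥ K, ∃ t : ℝ, r = ρ ^ n * t ∧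
      ρ * eta N ρ d (n + 1) ≤ t ∧ t ≤ eta N ρ d n := by
  have hr4 := rho_lt hN hρ1
  have hpos : 0 < ρ ^ K / 2 := by positivity
  filter_upwards [Ioo_mem_nhdsGT hpos] with r hr
  have hex : ∃ m : ℕ, ρ ^ m * eta N ρ d m ≤ r := by
    obtain ⟨m, hm⟩ := exists_pow_lt_of_lt_one hr.1 (show ρ < 1 by linarith)
    refine ⟨m, le_trans ?_ hm.le⟩
    exact mul_le_of_le_one_right (by positivity) (eta_le hN hρ0 hρ1 hd m)
  classical
  obtain ⟨m, hm, hmin⟩ : ∃ m : ℕ, ρ ^ m * eta N ρ d m ≤ r ∧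
      ∀ l < m, ¬ ρ ^ l * eta N ρ d l ≤ r :=
    ⟨Nat.find hex, Nat.find_spec hex, fun l hl => Nat.find_min hex hl⟩
  have hKm : K < m := by
    by_contra hcon
    push Not at hcon
    have h1 : ρ ^ K ≤ ρ ^ m := pow_le_pow_of_le_one hρ0.le (by linarith) hcon
    have h2 := mul_le_mul_of_nonneg_left (eta_ge (N := N) (ρ := ρ) d m)
      (show 0 ≤ ρ ^ m by positivity)
    have := hr.2
    linarith
  obtain ⟨n, rfl⟩ : ∃ n, m = n + 1 := ⟨m - 1, by omega⟩
  have hn := hmin n (by omega)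
  push Not at hn
  have hp : 0 < ρ ^ n := by positivity
  refine ⟨n, by omega, r / ρ ^ n, by field_simp, ?_, ?_⟩
  · rw [le_div_iff₀ hp]
    rw [pow_succ] at hm
    linarith
  · rw [div_le_iff₀ hp]; linarith

lemma lower_level [IsProbabilityMeasure μ] (hN : 2 ≤ N) (hρ0 : 0 < ρ) (hρ1 : ρ ≤ 1 / (N : ℝ) ^ 2)
    (hs : s = -Real.log N / Real.log ρ)
    (hss : IsSelfSimilar N ρ μ) {d : ℕ → ℕ} (hd : ∀ i, d i < N) (n j : ℕ)
    (hj : j ≤ min (d n) (N - 1 - d n)) {u : ℝ}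
    (hu : j * (R N ρ / ρ) + eta N ρ d (n + 1) < u) :
    (1 + 2 * (j : ℝ)) / ((2 : ℝ) ^ s * u ^ s) ≤
      μ.real (Ioo (piMap N ρ d - ρ ^ (n + 1) * u) (piMap N ρ d + ρ ^ (n + 1) * u)) /
        (2 * (ρ ^ (n + 1) * u)) ^ s := by
  have hNr : (2 : ℝ) ≤ N := by exact_mod_cast hN
  obtain ⟨hs0, hs1, hρs⟩ := s_bounds hN hρ0 hρ1 hs
  have ha := a_ge hN hρ0 hρ1
  have he1 := eta_ge (N := N) (ρ := ρ) d (n + 1)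
  have hup : 0 < u := by
    have : 0 ≤ (j : ℝ) * (R N ρ / ρ) := mul_nonneg (by positivity) (by linarith)
    linarith
  have hk := hd n
  have h1 := level_lower hN hρ0 hρ1 hss (k := d n) (j := j) (by omega) (by omega) hu
  rw [← Tn_eq hN hρ0 hρ1 hd n] at h1
  have h2 := scale_le hN hρ0 hρ1 hss hd n (ρ * u)
  have h3 := mul_le_mul_of_nonneg_left h1 (show 0 ≤ ((N : ℝ)⁻¹) ^ n by positivity)
  rw [← mul_assoc, ← pow_succ] at h3 h2
  rw [Real.mul_rpow (x := 2) (by norm_num) (by positivity), Real.mul_rpow (by positivity) hup.le,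
    ← Real.rpow_natCast ρ (n + 1), ← Real.rpow_mul hρ0.le, mul_comm ((n + 1 : ℕ) : ℝ) s,
    Real.rpow_mul hρ0.le, hρs, Real.rpow_natCast, Real.rpow_natCast]
  have hNp : 0 < ((N : ℝ)⁻¹) ^ (n + 1) := by positivity
  rw [div_le_div_iff₀ (by positivity) (by positivity)]
  have h4 := mul_le_mul_of_nonneg_right (h3.trans h2) (show 0 ≤ (2 : ℝ) ^ s * u ^ s by positivity)
  linarith

lemma freq_transfer (hρ0 : 0 < ρ) (hρ1 : ρ < 1) {F : ℝ → ℝ} {c B : ℝ}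
    (h : ∃ᶠ n : ℕ in atTop, ∃ u : ℝ, 0 < u ∧ u ≤ B ∧ c ≤ F (ρ ^ (n + 1) * u)) :
    ∃ᶠ r in 𝓝[>] (0 : ℝ), c ≤ F r := by
  intro hcon
  rw [eventually_nhdsWithin_iff, Metric.eventually_nhds_iff] at hcon
  obtain ⟨ε, hε, hcon⟩ := hcon
  have hlim : Tendsto (fun n : ℕ => ρ ^ (n + 1) * B) atTop (𝓝 0) := by
    have := ((tendsto_pow_atTop_nhds_zero_of_lt_one hρ0.le hρ1).comp
      (tendsto_add_atTop_nat 1)).mul_const B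
    simpa using this
  have hev := hlim.eventually (gt_mem_nhds hε)
  obtain ⟨n, ⟨u, hu0, huB, hF⟩, hn⟩ := (h.and_eventually hev).exists
  have hp : 0 < ρ ^ (n + 1) := by positivity
  refine hcon ?_ (show ρ ^ (n + 1) * u ∈ Ioi 0 from by simp; positivity) hF
  rw [dist_zero_right, Real.norm_of_nonneg (by positivity)]
  exact lt_of_le_of_lt (mul_le_mul_of_nonneg_left huB hp.le) hn

lemma cont_aux {A s b : ℝ} (hA : 0 < A) :
    ContinuousAt (fun y : ℝ => b / ((2 : ℝ) ^ s * y ^ s)) A := by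
  refine ContinuousAt.div continuousAt_const ?_ (by positivity)
  exact continuousAt_const.mul (Real.continuousAt_rpow_const _ _ (Or.inl hA.ne'))

lemma one_le_aux {s y : ℝ} (hs0 : 0 ≤ s) (hy : 1 / 2 ≤ y) : 1 ≤ (2 : ℝ) ^ s * y ^ s := by
  rw [← Real.mul_rpow (by norm_num) (by linarith)]
  exact Real.one_le_rpow (by linarith) hs0

end final

/-- Theorem 1 (ii): pointwise upper `s`-density of the homogeneous Cantor measure. -/
theorem upperDensity_eq (N : ℕ) (hN : 2 ≤ N) (ρ : ℝ) (hρ0 : 0 < ρ)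
    (hρ1 : ρ ≤ 1 / (N : ℝ) ^ 2) (s : ℝ) (hs : s = -Real.log N / Real.log ρ)
    (μ : Measure ℝ) (hprob : IsProbabilityMeasure μ) (hss : IsSelfSimilar N ρ μ)
    (d : ℕ → ℕ) (hd : ∀ i, d i < N) :
    upperDensity μ s (piMap N ρ d) =
      max
        (1 / ((2 : ℝ) ^ s *
          (liminf (fun n : ℕ =>
            max (Tn N ρ d (n + 1)) (1 - Tn N ρ d (n + 1))) atTop) ^ s))
        (limsup (fun n : ℕ =>
          (1 + 2 * ((min (d n) (N - 1 - d n) : ℕ) : ℝ)) /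
            ((2 : ℝ) ^ s *
              (((min (d n) (N - 1 - d n) : ℕ) : ℝ) * R N ρ / ρ +
                max (Tn N ρ d (n + 1)) (1 - Tn N ρ d (n + 1))) ^ s)) atTop) := by
  have hNr : (2 : ℝ) ≤ N := by exact_mod_cast hN
  obtain ⟨hs0, hs1, hρs⟩ := s_bounds hN hρ0 hρ1 hs
  have ha := a_ge hN hρ0 hρ1
  have hR := R_pos hN hρ1
  have hr4 := rho_lt hN hρ1
  change upperDensity μ s (piMap N ρ d) =
      max (1 / ((2 : ℝ) ^ s * (liminf (fun n : ℕ => eta N ρ d (n + 1)) atTop) ^ s))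
        (limsup (fun n : ℕ => (1 + 2 * ((min (d n) (N - 1 - d n) : ℕ) : ℝ)) /
            ((2 : ℝ) ^ s * (((min (d n) (N - 1 - d n) : ℕ) : ℝ) * R N ρ / ρ +
                eta N ρ d (n + 1)) ^ s)) atTop)
  set D : ℕ → ℝ := fun n : ℕ => (1 + 2 * ((min (d n) (N - 1 - d n) : ℕ) : ℝ)) /
            ((2 : ℝ) ^ s * (((min (d n) (N - 1 - d n) : ℕ) : ℝ) * R N ρ / ρ +
                eta N ρ d (n + 1)) ^ s) with hD
  set l := liminf (fun n : ℕ => eta N ρ d (n + 1)) atTop with hl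
  set F : ℝ → ℝ := fun r : ℝ =>
    μ.real (Ioo (piMap N ρ d - r) (piMap N ρ d + r)) / (2 * r) ^ s with hF
  have hFdef : upperDensity μ s (piMap N ρ d) = limsup F (𝓝[>] 0) := rfl
  rw [hFdef]
  have hAnn : ∀ n : ℕ, 0 ≤ ((min (d n) (N - 1 - d n) : ℕ) : ℝ) * R N ρ / ρ := fun n => by positivity
  have hcard : ∀ n : ℕ, ((min (d n) (N - 1 - d n) : ℕ) : ℝ) ≤ N := by
    intro n
    have := hd n
    exact_mod_cast (show min (d n) (N - 1 - d n) ≤ N by omega)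
  have hD0 : ∀ n, 0 ≤ D n := by
    intro n
    have h1 := hAnn n
    have h2 := eta_ge (N := N) (ρ := ρ) d (n + 1)
    refine div_nonneg (by positivity) (mul_nonneg (by positivity) (Real.rpow_nonneg ?_ _))
    linarith
  have hDle : ∀ n, D n ≤ 1 + 2 * N := by
    intro n
    have h1 := hAnn n
    have h2 := eta_ge (N := N) (ρ := ρ) d (n + 1)
    have h3 := hcard n
    refine (div_le_self (by positivity) (one_le_aux hs0 (by linarith))).trans ?_
    linarith
  have hEle : ∀ n, 1 / ((2 : ℝ) ^ s * eta N ρ d n ^ s) ≤ 1 := fun n =>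
    div_le_self (by norm_num) (one_le_aux hs0 (eta_ge d n))
  have hup : ∀ c : ℝ, (∀ᶠ n : ℕ in atTop, 1 / ((2 : ℝ) ^ s * eta N ρ d (n + 1) ^ s) ≤ c) →
      (∀ᶠ n : ℕ in atTop, D n ≤ c) → ∀ᶠ r in 𝓝[>] (0 : ℝ), F r ≤ c := by
    intro c hE hDc
    obtain ⟨K1, hK1⟩ := eventually_atTop.1 hE
    obtain ⟨K2, hK2⟩ := eventually_atTop.1 hDc
    filter_upwards [covering hN hρ0 hρ1 hd (K1 + K2 + 1)] with r hr
    obtain ⟨n, hn, t, rfl, ht0, ht1⟩ := hr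
    have e2 := hK1 (n - 1) (by omega)
    rw [show n - 1 + 1 = n by omega] at e2
    exact upper_level hN hρ0 hρ1 hs hss hd n (hK1 n (by omega)) e2 (hK2 n (by omega)) ht0 ht1
  have hFb : IsBoundedUnder (· ≤ ·) (𝓝[>] (0 : ℝ)) F :=
    ⟨1 + 2 * N, by
      rw [eventually_map]
      exact hup _ (Eventually.of_forall fun n => (hEle _).trans (by linarith))
        (Eventually.of_forall hDle)⟩
  have hF0 : ∀ᶠ r in 𝓝[>] (0 : ℝ), 0 ≤ F r := by
    filter_upwards [self_mem_nhdsWithin] with r hr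
    have : 0 < r := hr
    exact div_nonneg measureReal_nonneg (by positivity)
  have hFb' : IsBoundedUnder (· ≥ ·) (𝓝[>] (0 : ℝ)) F := ⟨0, by rw [eventually_map]; exact hF0⟩
  have hFc : IsCoboundedUnder (· ≤ ·) (𝓝[>] (0 : ℝ)) F := hFb'.isCoboundedUnder_le
  have hηb : IsBoundedUnder (· ≥ ·) atTop (fun n : ℕ => eta N ρ d (n + 1)) :=
    ⟨1 / 2, by rw [eventually_map]; exact Eventually.of_forall fun n => eta_ge d (n + 1)⟩
  have hηb' : IsBoundedUnder (· ≤ ·) atTop (fun n : ℕ => eta N ρ d (n + 1)) :=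
    ⟨1, by rw [eventually_map]; exact Eventually.of_forall fun n => eta_le hN hρ0 hρ1 hd (n + 1)⟩
  have hDb : IsBoundedUnder (· ≤ ·) atTop D :=
    ⟨1 + 2 * N, by rw [eventually_map]; exact Eventually.of_forall hDle⟩
  have hDb' : IsBoundedUnder (· ≥ ·) atTop D :=
    ⟨0, by rw [eventually_map]; exact Eventually.of_forall hD0⟩
  have hl2 : 1 / 2 ≤ l :=
    le_liminf_of_le hηb'.isCoboundedUnder_ge (Eventually.of_forall fun n => eta_ge d (n + 1))
  have hlp : 0 < l := by linarith
  apply le_antisymm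
  · refine le_of_forall_gt_imp_ge_of_dense fun c hc => ?_
    rw [max_lt_iff] at hc
    refine limsup_le_of_le hFc (hup c ?_ ?_)
    · have hcont := (cont_aux (A := l) (s := s) (b := 1) hlp).eventually (gt_mem_nhds hc.1)
      have hev : ∀ᶠ y in 𝓝[<] l, (1 / ((2 : ℝ) ^ s * y ^ s) < c ∧ 0 < y) ∧ y < l :=
        ((hcont.and (lt_mem_nhds hlp)).filter_mono nhdsWithin_le_nhds).and self_mem_nhdsWithin
      obtain ⟨l', ⟨h1, h2⟩, h3⟩ := hev.exists
      have := eventually_lt_of_lt_liminf (h3.trans_eq hl) hηb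
      filter_upwards [this] with n hn
      refine le_trans ?_ h1.le
      apply one_div_le_one_div_of_le (by positivity)
      exact mul_le_mul_of_nonneg_left (Real.rpow_le_rpow h2.le hn.le hs0) (by positivity)
    · exact (eventually_lt_of_limsup_lt hc.2 hDb).mono fun n hn => hn.le
  · apply max_le
    · refine le_of_forall_lt_imp_le_of_dense fun c hc => ?_
      refine le_limsup_of_frequently_le ?_ hFb
      have hcont := (cont_aux (A := l) (s := s) (b := 1) hlp).eventually (lt_mem_nhds hc)
      have hev : ∀ᶠ y in 𝓝[>] l, c < 1 / ((2 : ℝ) ^ s * y ^ s) ∧ l < y :=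
        (hcont.filter_mono nhdsWithin_le_nhds).and self_mem_nhdsWithin
      obtain ⟨l', h1, h3⟩ := hev.exists
      have hfr := frequently_lt_of_liminf_lt hηb'.isCoboundedUnder_ge (hl.symm.trans_lt h3)
      refine freq_transfer hρ0 (by linarith) (B := l') (hfr.mono fun n hn => ?_)
      refine ⟨l', by linarith, le_rfl, h1.le.trans ?_⟩
      have := lower_level hN hρ0 hρ1 hs hss hd n 0 (Nat.zero_le _) (u := l') (by simpa using hn)
      simpa using this
    · refine le_of_forall_lt_imp_le_of_dense fun c hc => ?_
      refine le_limsup_of_frequently_le ?_ hFb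
      have hfr := frequently_lt_of_lt_limsup hDb'.isCoboundedUnder_le hc
      refine freq_transfer hρ0 (by linarith) (B := N * (R N ρ / ρ) + 2) (hfr.mono fun n hn => ?_)
      set A := ((min (d n) (N - 1 - d n) : ℕ) : ℝ) * R N ρ / ρ + eta N ρ d (n + 1) with hA
      have hη := eta_ge (N := N) (ρ := ρ) d (n + 1)
      have hη' := eta_le hN hρ0 hρ1 hd (n + 1)
      have hA0 : 0 < A := by have := hAnn n; linarith
      have hcont := (cont_aux (A := A) (s := s)
        (b := 1 + 2 * ((min (d n) (N - 1 - d n) : ℕ) : ℝ)) hA0).eventually (lt_mem_nhds hn)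
      have hev : ∀ᶠ y in 𝓝[>] A, (c < (1 + 2 * ((min (d n) (N - 1 - d n) : ℕ) : ℝ)) /
          ((2 : ℝ) ^ s * y ^ s) ∧ y < A + 1) ∧ A < y :=
        ((hcont.and (gt_mem_nhds (lt_add_one A))).filter_mono nhdsWithin_le_nhds).and
          self_mem_nhdsWithin
      obtain ⟨u, ⟨h1, h2⟩, h3⟩ := hev.exists
      refine ⟨u, by linarith, ?_, h1.le.trans ?_⟩
      · have := mul_le_mul_of_nonneg_right (hcard n) (show 0 ≤ R N ρ / ρ by linarith)
        rw [← mul_div_assoc] at this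
        linarith
      · exact lower_level hN hρ0 hρ1 hs hss hd n _ le_rfl (by rw [← mul_div_assoc]; exact h3)

end HomogeneousCantorDensity
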